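/- arXiv:2605.26700 — 2 statements merged into one kernel-verified Lean document; each statement's English description precedes it below -/
import Mathlib

section
/- Let U ⊆ ℂⁿ be open and let φ : ℂⁿ → ℝ be C² on U with φ(x) < 0 for all x ∈ U and Levi form L_φ(x)(v) ≥ 0 for all x ∈ U and v ∈ ℂⁿ (i.e. φ is a negative C² plurisubharmonic function on U). Fix ε > 0 and define ψ : ℂⁿ → ℝ by ψ(x) := −ε · Real.log (−φ(x)). Then ψ is C² on U, L_ψ(x)(v) ≥ 0 for all x ∈ U and v ∈ ℂⁿ (ψ is plurisubharmonic), and for all x ∈ U and v ∈ ℂⁿ one has ‖∂ψ(x)(v)‖² ≤ ε · L_ψ(x)(v) (the pointwise form of the (1,1)-form inequality i∂ψ∧∂̄ψ ≤ ε·i∂∂̄ψ). -/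
open Complex

/-- The (1,0)-differential of a real-valued function `f` on `ℂⁿ` at `x` in
direction `v`: `∂f(x)(v) = (1/2)·(Df(x)(v) − i·Df(x)(i·v))`. -/
noncomputable def delForm {n : ℕ} (f : EuclideanSpace ℂ (Fin n) → ℝ)
    (x v : EuclideanSpace ℂ (Fin n)) : ℂ :=
  (1 / 2 : ℂ) * ((fderiv ℝ f x v : ℂ) - Complex.I * (fderiv ℝ f x (Complex.I • v) : ℂ))

/-- The Levi form of a real-valued function `f` on `ℂⁿ` at `x` in direction `v`:
`L_f(x)(v) = (1/4)·(D²f(x)(v,v) + D²f(x)(i·v,i·v))`. -/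
noncomputable def leviForm {n : ℕ} (f : EuclideanSpace ℂ (Fin n) → ℝ)
    (x v : EuclideanSpace ℂ (Fin n)) : ℝ :=
  (1 / 4) * (fderiv ℝ (fderiv ℝ f) x v v
    + fderiv ℝ (fderiv ℝ f) x (Complex.I • v) (Complex.I • v))

/-- The first derivative of `x ↦ c * log (-f x)`. -/
theorem hasFDerivAt_const_mul_log_neg {E : Type*} [NormedAddCommGroup E] [NormedSpace ℝ E]
    {f : E → ℝ} {f' : E →L[ℝ] ℝ} {x : E} (c : ℝ) (hf : HasFDerivAt f f' x) (hx : f x ≠ 0) :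
    HasFDerivAt (fun y => c * Real.log (-f y)) ((c * (f x)⁻¹) • f') x := by
  refine HasFDerivAt.congr_fderiv (hf.fun_neg.log (neg_ne_zero.mpr hx) |>.const_mul c) ?_
  ext v
  simp [mul_assoc, inv_neg]

/-- The second derivative of `x ↦ c * log (-f x)`. -/
theorem fderiv_fderiv_const_mul_log_neg {E : Type*} [NormedAddCommGroup E] [NormedSpace ℝ E]
    {f : E → ℝ} {x : E} (c : ℝ) (hf : ContDiffAt ℝ 2 f x) (hx : f x ≠ 0) (v w : E) :
    fderiv ℝ (fderiv ℝ (fun y => c * Real.log (-f y))) x v w =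
      c * ((f x)⁻¹ * fderiv ℝ (fderiv ℝ f) x v w
        - ((f x)⁻¹) ^ 2 * (fderiv ℝ f x v * fderiv ℝ f x w)) := by
  have hev : fderiv ℝ (fun y => c * Real.log (-f y)) =ᶠ[nhds x]
      fun y => (c * (f y)⁻¹) • fderiv ℝ f y := by
    filter_upwards [hf.eventually (by simp), hf.continuousAt.eventually_ne hx] with y hy hy0
    exact (hasFDerivAt_const_mul_log_neg c
      (hy.differentiableAt (by norm_num)).hasFDerivAt hy0).fderiv
  have hd : HasFDerivAt f (fderiv ℝ f x) x := (hf.differentiableAt (by norm_num)).hasFDerivAt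
  have hd2 : HasFDerivAt (fderiv ℝ f) (fderiv ℝ (fderiv ℝ f) x) x :=
    ((hf.fderiv_right (m := 1) (by norm_num)).differentiableAt (by norm_num)).hasFDerivAt
  have hinv : HasFDerivAt (fun y => c * (f y)⁻¹) _ x :=
    ((hasDerivAt_inv hx).comp_hasFDerivAt x hd).const_mul c
  rw [hev.fderiv_eq, (hinv.fun_smul hd2).fderiv]
  simp
  ring

theorem norm_delForm_sq {n : ℕ} (f : EuclideanSpace ℂ (Fin n) → ℝ)
    (x v : EuclideanSpace ℂ (Fin n)) :
    ‖delForm f x v‖ ^ 2 =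
      (1 / 4) * (fderiv ℝ f x v ^ 2 + fderiv ℝ f x (Complex.I • v) ^ 2) := by
  rw [delForm, norm_mul, mul_pow, Complex.sq_norm (_ - _), Complex.normSq_apply]
  simp
  ring

theorem delForm_const_mul_log_neg {n : ℕ} {f : EuclideanSpace ℂ (Fin n) → ℝ}
    {x : EuclideanSpace ℂ (Fin n)} (c : ℝ) (hf : DifferentiableAt ℝ f x) (hx : f x ≠ 0)
    (v : EuclideanSpace ℂ (Fin n)) :
    delForm (fun y => c * Real.log (-f y)) x v = ((c * (f x)⁻¹ : ℝ) : ℂ) * delForm f x v := by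
  simp only [delForm, (hasFDerivAt_const_mul_log_neg c hf.hasFDerivAt hx).fderiv,
    smul_apply, smul_eq_mul]
  push_cast
  ring

theorem leviForm_const_mul_log_neg {n : ℕ} {f : EuclideanSpace ℂ (Fin n) → ℝ}
    {x : EuclideanSpace ℂ (Fin n)} (c : ℝ) (hf : ContDiffAt ℝ 2 f x) (hx : f x ≠ 0)
    (v : EuclideanSpace ℂ (Fin n)) :
    leviForm (fun y => c * Real.log (-f y)) x v =
      c * ((f x)⁻¹ * leviForm f x v - ((f x)⁻¹) ^ 2 * ‖delForm f x v‖ ^ 2) := by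
  rw [norm_delForm_sq, leviForm, leviForm, fderiv_fderiv_const_mul_log_neg c hf hx,
    fderiv_fderiv_const_mul_log_neg c hf hx]
  ring

/-- If `φ` is a negative C² plurisubharmonic function on an open `U ⊆ ℂⁿ` and
`ε > 0`, then `ψ = −ε·log(−φ)` is C² plurisubharmonic on `U` and satisfies
`i∂ψ∧∂̄ψ ≤ ε·i∂∂̄ψ`, i.e. pointwise `‖∂ψ(x)(v)‖² ≤ ε·L_ψ(x)(v)`. -/
theorem log_psh_self_bounded_gradient {n : ℕ}
    (U : Set (EuclideanSpace ℂ (Fin n))) (hU : IsOpen U)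
    (φ : EuclideanSpace ℂ (Fin n) → ℝ) (hφ : ContDiffOn ℝ 2 φ U)
    (hneg : ∀ x ∈ U, φ x < 0)
    (hpsh : ∀ x ∈ U, ∀ v, 0 ≤ leviForm φ x v)
    (ε : ℝ) (hε : 0 < ε) :
    ContDiffOn ℝ 2 (fun x => -ε * Real.log (-φ x)) U ∧
      (∀ x ∈ U, ∀ v, 0 ≤ leviForm (fun x => -ε * Real.log (-φ x)) x v) ∧
      ∀ x ∈ U, ∀ v,
        ‖delForm (fun x => -ε * Real.log (-φ x)) x v‖ ^ 2
          ≤ ε * leviForm (fun x => -ε * Real.log (-φ x)) x v := by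
  have hC : ∀ x ∈ U, ContDiffAt ℝ 2 φ x := fun x hx => hφ.contDiffAt (hU.mem_nhds hx)
  have hbound : ∀ x ∈ U, ∀ v, ‖delForm (fun x => -ε * Real.log (-φ x)) x v‖ ^ 2
      ≤ ε * leviForm (fun x => -ε * Real.log (-φ x)) x v := by
    intro x hx v
    rw [delForm_const_mul_log_neg _ ((hC x hx).differentiableAt (by norm_num)) (hneg x hx).ne,
      leviForm_const_mul_log_neg _ (hC x hx) (hneg x hx).ne, norm_mul, mul_pow,
      Complex.norm_real, Real.norm_eq_abs, sq_abs]
    have h : 0 ≤ ε ^ 2 * (-(φ x)⁻¹ * leviForm φ x v) :=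
      mul_nonneg (sq_nonneg ε)
        (mul_nonneg (neg_nonneg.mpr (inv_nonpos.mpr (hneg x hx).le)) (hpsh x hx v))
    linarith
  refine ⟨contDiffOn_const.mul (hφ.neg.log fun x hx => neg_ne_zero.mpr (hneg x hx).ne),
    fun x hx v => ?_, hbound⟩
  exact nonneg_of_mul_nonneg_right ((sq_nonneg _).trans (hbound x hx v)) hε
end

section
/- Let U ⊆ ℂⁿ be open and let ρ : ℂⁿ → ℝ be C² on U with −1 < ρ(x) < 0 for all x ∈ U. Define σ : ℂⁿ → ℝ by σ(x) := 1 / Real.log (−ρ(x)). Then σ is C² on U and for every x ∈ U and v ∈ ℂⁿ the following identity holds: L_σ(x)(v) = (σ(x)² / (−ρ(x))) · ( L_ρ(x)(v) + ((1 + 2σ(x)) / (−ρ(x))) · ‖∂ρ(x)(v)‖² ). -/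
open Complex

open Filter Topology in
/-- Chain rule for the second derivative of `g ∘ f` with `g` a function of one real variable. -/
theorem fderiv_fderiv_comp_real {E : Type*} [NormedAddCommGroup E] [NormedSpace ℝ E]
    {f : E → ℝ} {x : E} (hf : ContDiffAt ℝ 2 f x) {g g' : ℝ → ℝ} {g'' : ℝ}
    (hg : ∀ᶠ s in 𝓝 (f x), HasDerivAt g (g' s) s) (hg' : HasDerivAt g' g'' (f x)) (v w : E) :
    fderiv ℝ (fderiv ℝ (fun y => g (f y))) x v w
      = g' (f x) * fderiv ℝ (fderiv ℝ f) x v w + g'' * (fderiv ℝ f x v * fderiv ℝ f x w) := by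
  have hev : fderiv ℝ (fun y => g (f y)) =ᶠ[𝓝 x] fun y => g' (f y) • fderiv ℝ f y := by
    filter_upwards [hf.continuousAt.eventually hg, hf.eventually (by simp)] with y hgy hfy
    exact (hgy.comp_hasFDerivAt y (hfy.differentiableAt (by simp)).hasFDerivAt).fderiv
  have hDf : HasFDerivAt (fderiv ℝ f) (fderiv ℝ (fderiv ℝ f) x) x :=
    ((hf.fderiv_right (m := 1) (by norm_num)).differentiableAt (by simp)).hasFDerivAt
  have hg'f : HasFDerivAt (fun y => g' (f y)) (g'' • fderiv ℝ f x) x :=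
    hg'.comp_hasFDerivAt x (hf.differentiableAt (by simp)).hasFDerivAt
  rw [hev.fderiv_eq, (hg'f.fun_smul hDf).fderiv]
  simp [mul_assoc]

theorem hasDerivAt_one_div_log_neg {s : ℝ} (hs : -1 < s ∧ s < 0) :
    HasDerivAt (fun r => 1 / Real.log (-r)) ((1 / Real.log (-s)) ^ 2 / (-s)) s := by
  have hs0 : s ≠ 0 := hs.2.ne
  have hlog : Real.log (-s) ≠ 0 := (Real.log_neg (by linarith) (by linarith)).ne
  have h := ((hasDerivAt_neg' s).log (neg_ne_zero.2 hs0)).fun_inv hlog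
  simp only [one_div]
  refine h.congr_deriv ?_
  field_simp

theorem hasDerivAt_one_div_log_neg_sq_div {s : ℝ} (hs : -1 < s ∧ s < 0) :
    HasDerivAt (fun r => (1 / Real.log (-r)) ^ 2 / (-r))
      ((1 / Real.log (-s)) ^ 2 / (-s) * ((1 + 2 * (1 / Real.log (-s))) / (-s))) s := by
  have hs0 : s ≠ 0 := hs.2.ne
  have hlog : Real.log (-s) ≠ 0 := (Real.log_neg (by linarith) (by linarith)).ne
  have h := ((hasDerivAt_one_div_log_neg hs).fun_pow 2).fun_div (hasDerivAt_neg' s)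
    (neg_ne_zero.2 hs0)
  refine h.congr_deriv ?_
  push_cast
  field_simp
  ring

/-- For `−1 < ρ < 0` of class C² on an open `U ⊆ ℂⁿ`, the function
`σ = 1/log(−ρ)` is C² and satisfies
`i∂∂̄σ = (σ²/(−ρ))·( i∂∂̄ρ + ((1+2σ)/(−ρ))·i∂ρ∧∂̄ρ )` pointwise. -/
theorem leviForm_one_div_log_neg {n : ℕ}
    (U : Set (EuclideanSpace ℂ (Fin n))) (hU : IsOpen U)
    (ρ : EuclideanSpace ℂ (Fin n) → ℝ) (hρ : ContDiffOn ℝ 2 ρ U)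
    (hbound : ∀ x ∈ U, -1 < ρ x ∧ ρ x < 0) :
    ContDiffOn ℝ 2 (fun x => 1 / Real.log (-ρ x)) U ∧
      ∀ x ∈ U, ∀ v,
        leviForm (fun x => 1 / Real.log (-ρ x)) x v
          = ((1 / Real.log (-ρ x)) ^ 2 / (-ρ x)) *
              (leviForm ρ x v
                + ((1 + 2 * (1 / Real.log (-ρ x))) / (-ρ x)) * ‖delForm ρ x v‖ ^ 2) := by
  have hlog : ∀ x ∈ U, Real.log (-ρ x) ≠ 0 := fun x hx =>
    (Real.log_neg (by linarith [(hbound x hx).2]) (by linarith [(hbound x hx).1])).ne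
  refine ⟨contDiffOn_const.div
    (hρ.neg.log fun x hx => neg_ne_zero.2 (hbound x hx).2.ne) hlog, fun x hx v => ?_⟩
  have hf : ContDiffAt ℝ 2 ρ x := hρ.contDiffAt (hU.mem_nhds hx)
  have hD2 := fderiv_fderiv_comp_real hf
    ((isOpen_Ioo.mem_nhds (hbound x hx) : Set.Ioo (-1 : ℝ) 0 ∈ nhds (ρ x)) |>
      Filter.mem_of_superset <| fun s hs => hasDerivAt_one_div_log_neg hs)
    (hasDerivAt_one_div_log_neg_sq_div (hbound x hx))
  rw [norm_delForm_sq, leviForm, leviForm, hD2, hD2]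
  ring
end
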